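/- Assume α = (β+1)/2, 0 < β ≤ 1, and γ = 1 (line L₃₄). Then there exist M > 0 and functions λ₁, λ₃ : ℝ → ℂ such that for every μ > M, λ₁(μ), its complex conjugate, λ₃(μ), and its complex conjugate are roots of f(·, μ), and as μ → ∞: Re λ₁(μ) = −(1/4)(1+o(1)), Im λ₁(μ) = √2 · μ^(β/2)(1+o(1)), Re λ₃(μ) = −(1/4)(1+o(1)), and Im λ₃(μ) = (√15/4)(1+o(1)). In particular, the real parts of all four roots stay bounded away from 0, consistent with exponential stability on L₃₄. -/

import Mathlib

open Filter Real Topology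

/-- Characteristic polynomial of the thermoelastic system with Cattaneo's law,
with inertial coefficient `m = 1`, wave speed `σ = 2`, relaxation `τ = 1`:
`f(λ, μ) = (μ^γ+1)λ⁴ + (μ^γ+1)λ³ + (μ^(2α)+μ^(β+γ)+2μ+μ^β)λ² + (μ^(2α)+2μ)λ + 2μ^(1+β)`. -/
noncomputable def charPoly (α β γ μ : ℝ) (l : ℂ) : ℂ :=
  ((μ ^ γ + 1 : ℝ) : ℂ) * l ^ 4 + ((μ ^ γ + 1 : ℝ) : ℂ) * l ^ 3 +
    ((μ ^ (2 * α) + μ ^ (β + γ) + 2 * μ + μ ^ β : ℝ) : ℂ) * l ^ 2 +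
    ((μ ^ (2 * α) + 2 * μ : ℝ) : ℂ) * l + ((2 * μ ^ (1 + β) : ℝ) : ℂ)

open Polynomial in
/-- A monic complex polynomial that is small at `w` has a root near `w`. -/
theorem exists_root_norm_sub_pow_le {p : ℂ[X]} (hp : p.Monic) (hdeg : p.natDegree ≠ 0) (w : ℂ) :
    ∃ z, p.eval z = 0 ∧ ‖w - z‖ ^ p.natDegree ≤ ‖p.eval w‖ := by
  classical
  have hs : p.Splits := IsAlgClosed.splits p
  have hcard : p.natDegree = p.roots.card := hs.natDegree_eq_card_roots
  have hne : p.roots.toFinset.Nonempty := by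
    rw [Multiset.toFinset_nonempty]
    intro h
    rw [h] at hcard
    exact hdeg (by simpa using hcard)
  obtain ⟨z, hz, hmin⟩ := Finset.exists_min_image _ (fun z => ‖w - z‖) hne
  rw [Multiset.mem_toFinset] at hz
  refine ⟨z, (mem_roots'.mp hz).2, ?_⟩
  have h := Multiset.prod_map_le_prod_map₀ (s := p.roots) (fun _ => ‖w - z‖) (fun y => ‖w - y‖)
    (fun _ _ => norm_nonneg _) (fun y hy => hmin y (Multiset.mem_toFinset.mpr hy))
  rw [Multiset.map_const', Multiset.prod_replicate, ← hcard] at h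
  refine h.trans (le_of_eq ?_)
  rw [hs.eval_eq_prod_roots_of_monic hp]
  exact Multiset.prod_hom' p.roots (normHom : ℂ →*₀ ℝ) (fun y => w - y)

open Polynomial in
/-- Continuity of a root of a monic quartic in terms of its coefficients. -/
theorem exists_tendsto_quartic_root {ι : Type*} {F : Filter ι} {a b c d : ι → ℂ}
    {a₀ b₀ c₀ d₀ w : ℂ} (ha : Tendsto a F (𝓝 a₀)) (hb : Tendsto b F (𝓝 b₀))
    (hc : Tendsto c F (𝓝 c₀)) (hd : Tendsto d F (𝓝 d₀))
    (hw : w ^ 4 + a₀ * w ^ 3 + b₀ * w ^ 2 + c₀ * w + d₀ = 0) :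
    ∃ z : ι → ℂ, (∀ i, z i ^ 4 + a i * z i ^ 3 + b i * z i ^ 2 + c i * z i + d i = 0) ∧
      Tendsto z F (𝓝 w) := by
  have hex : ∀ i, ∃ z : ℂ, z ^ 4 + a i * z ^ 3 + b i * z ^ 2 + c i * z + d i = 0 ∧
      ‖w - z‖ ^ 4 ≤ ‖w ^ 4 + a i * w ^ 3 + b i * w ^ 2 + c i * w + d i‖ := by
    intro i
    let p : ℂ[X] := X ^ 4 + C (a i) * X ^ 3 + C (b i) * X ^ 2 + C (c i) * X + C (d i)
    have hdeg : p.natDegree = 4 := by dsimp only [p]; compute_degree!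
    have hmonic : p.Monic := by dsimp only [p]; monicity!
    obtain ⟨z, hz, hle⟩ := exists_root_norm_sub_pow_le hmonic (by simp [hdeg]) w
    rw [hdeg] at hle
    exact ⟨z, by simpa [p] using hz, by simpa [p] using hle⟩
  choose z hz hle using hex
  refine ⟨z, hz, ?_⟩
  have hval : Tendsto (fun i => w ^ 4 + a i * w ^ 3 + b i * w ^ 2 + c i * w + d i) F (𝓝 0) := by
    rw [← hw]
    exact ((((ha.mul_const _).const_add _).add (hb.mul_const _)).add (hc.mul_const _)).add hd
  have hpow : Tendsto (fun i => ‖w - z i‖ ^ 4) F (𝓝 0) :=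
    squeeze_zero (fun _ => by positivity) hle (by simpa using hval.norm)
  rw [tendsto_iff_norm_sub_tendsto_zero]
  have hroot := hpow.rpow_const (p := ((4 : ℕ) : ℝ)⁻¹) (Or.inr (by positivity))
  rw [Real.zero_rpow (by norm_num)] at hroot
  refine hroot.congr fun i => ?_
  rw [Real.pow_rpow_inv_natCast (norm_nonneg _) (by norm_num), norm_sub_rev]

/-- A nonreal root `l` of a real quartic with leading coefficients `1, 1` splits off a real
quadratic factor; the roots of the cofactor are roots of the quartic. -/
theorem quartic_root_of_cofactor {A B C : ℝ} {l w : ℂ} (him : l.im ≠ 0)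
    (hl : l ^ 4 + l ^ 3 + A * l ^ 2 + B * l + C = 0)
    (hw : w ^ 2 + (1 + 2 * l.re : ℝ) * w +
      (A - (l.re ^ 2 + l.im ^ 2) + 2 * l.re * (1 + 2 * l.re) : ℝ) = 0) :
    w ^ 4 + w ^ 3 + A * w ^ 2 + B * w + C = 0 := by
  obtain ⟨u, v⟩ := l
  dsimp only at him hw
  set r : ℝ := 1 + 2 * u with hr
  set q : ℝ := u ^ 2 + v ^ 2 with hq
  set s : ℝ := A - q + 2 * u * r with hs
  have hdiv : ∀ y : ℂ, y ^ 4 + y ^ 3 + A * y ^ 2 + B * y + C =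
      (y ^ 2 - (2 * u : ℝ) * y + q) * (y ^ 2 + r * y + s) +
        ((B + 2 * u * s - r * q : ℝ) * y + (C - q * s : ℝ)) := by
    intro y
    rw [hs, hr]
    push_cast
    ring
  have hquad : (⟨u, v⟩ : ℂ) ^ 2 - (2 * u : ℝ) * ⟨u, v⟩ + q = 0 := by
    rw [hq]
    apply Complex.ext <;> simp [pow_two] <;> ring
  rw [hdiv, hquad, zero_mul, zero_add] at hl
  have h1 : B + 2 * u * s - r * q = 0 := by
    have := congrArg Complex.im hl
    rw [Complex.add_im, Complex.im_ofReal_mul, Complex.ofReal_im, add_zero, Complex.zero_im] at this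
    exact (mul_eq_zero.mp this).resolve_right him
  have h2 : C - q * s = 0 := by
    rw [h1] at hl
    simpa only [Complex.ofReal_zero, zero_mul, zero_add, Complex.ofReal_eq_zero] using hl
  rw [hdiv, h1, h2, hw]
  simp

/-- The root of `w ^ 2 + r * w + s` in the upper half-plane when `r ^ 2 / 4 ≤ s`. -/
theorem quadratic_root_of_discrim_nonpos {r s : ℝ} (h : 0 ≤ s - r ^ 2 / 4) :
    (⟨-(r / 2), √(s - r ^ 2 / 4)⟩ : ℂ) ^ 2 + r * ⟨-(r / 2), √(s - r ^ 2 / 4)⟩ + s = 0 := by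
  have hsq := Real.sq_sqrt h
  apply Complex.ext
  · simp [pow_two] at hsq ⊢
    linarith
  · simp [pow_two]
    ring

/-- Asymptotics of the roots of `l ^ 4 + l ^ 3 + A l ^ 2 + B l + C` when `A ~ 2 x`, `B ~ x`,
`C ~ 2 x` and `x → ∞`. -/
theorem exists_tendsto_quartic_roots {ι : Type*} {F : Filter ι} {A B C x : ι → ℝ}
    (hx : Tendsto x F atTop) (hA : Tendsto (fun i => A i / x i) F (𝓝 2))
    (hB : Tendsto (fun i => B i / x i) F (𝓝 1)) (hC : Tendsto (fun i => C i / x i) F (𝓝 2)) :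
    ∃ l1 l3 : ι → ℂ,
      (∀ᶠ i in F, l1 i ^ 4 + l1 i ^ 3 + A i * l1 i ^ 2 + B i * l1 i + C i = 0) ∧
      (∀ᶠ i in F, l3 i ^ 4 + l3 i ^ 3 + A i * l3 i ^ 2 + B i * l3 i + C i = 0) ∧
      Tendsto (fun i => (l1 i).re) F (𝓝 (-(1 / 4))) ∧
      Tendsto (fun i => (l1 i).im / √(2 * x i)) F (𝓝 1) ∧
      Tendsto (fun i => (l3 i).re) F (𝓝 (-(1 / 4))) ∧
      Tendsto (fun i => (l3 i).im) F (𝓝 (√(15) / 4)) := by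
  have h15 : √(15) * √(15) = (15 : ℝ) := Real.mul_self_sqrt (by norm_num)
  have h15pos : 0 < √(15) / 4 := by positivity
  have hxpos : ∀ᶠ i in F, 0 < x i := hx.eventually_gt_atTop 0
  have hxinv : Tendsto (fun i => (x i)⁻¹) F (𝓝 0) := hx.inv_tendsto_atTop
  have hCne : ∀ᶠ i in F, C i ≠ 0 := by
    filter_upwards [hC.eventually_ne two_ne_zero] with i hi h
    simp [h] at hi
  have hAC : Tendsto (fun i => A i / C i) F (𝓝 1) := by
    have h := hA.div hC two_ne_zero
    rw [div_self two_ne_zero] at h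
    refine h.congr' ?_
    filter_upwards [hxpos] with i hi using div_div_div_cancel_right₀ hi.ne' _ _
  have hBC : Tendsto (fun i => B i / C i) F (𝓝 (1 / 2)) := by
    refine (hB.div hC two_ne_zero).congr' ?_
    filter_upwards [hxpos] with i hi using div_div_div_cancel_right₀ hi.ne' _ _
  have hCinv : Tendsto (fun i => 1 / C i) F (𝓝 0) := by
    have h := hxinv.div hC two_ne_zero
    rw [zero_div] at h
    refine h.congr' ?_
    filter_upwards [hxpos] with i hi
    simp only [Pi.div_apply]
    field_simp
  set w : ℂ := ⟨-(1 / 4), -(√(15) / 4)⟩ with hw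
  have hwroot : w ^ 4 + ((1 / 2 : ℝ) : ℂ) * w ^ 3 + ((1 : ℝ) : ℂ) * w ^ 2 +
      ((0 : ℝ) : ℂ) * w + ((0 : ℝ) : ℂ) = 0 := by
    have hquad : w ^ 2 + ((1 / 2 : ℝ) : ℂ) * w + 1 = 0 := by
      apply Complex.ext
      · simp [hw, pow_two]
        linarith
      · simp [hw, pow_two]
        ring
    push_cast at hquad ⊢
    linear_combination w ^ 2 * hquad
  obtain ⟨z, hz, hzlim⟩ := exists_tendsto_quartic_root hBC.ofReal hAC.ofReal hCinv.ofReal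
    hCinv.ofReal hwroot
  have hwne : w ≠ 0 := fun h => h15pos.ne' (by simpa [hw] using congrArg Complex.im h)
  have hwinv : w⁻¹ = ⟨-(1 / 4), √(15) / 4⟩ := by
    refine inv_eq_of_mul_eq_one_right ?_
    apply Complex.ext
    · simp [hw]
      linarith
    · simp [hw]
      ring
  have hl3lim : Tendsto (fun i => (z i)⁻¹) F (𝓝 ⟨-(1 / 4), √(15) / 4⟩) :=
    hwinv ▸ hzlim.inv₀ hwne
  have hl3 : ∀ᶠ i in F, (z i)⁻¹ ^ 4 + (z i)⁻¹ ^ 3 + A i * (z i)⁻¹ ^ 2 + B i * (z i)⁻¹ + C i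
      = 0 := by
    filter_upwards [hCne, hzlim.eventually_ne hwne] with i hCi hzi
    have hCi' : (C i : ℂ) ≠ 0 := by exact_mod_cast hCi
    have h := hz i
    push_cast at h
    field_simp at h ⊢
    linear_combination h
  have hre : Tendsto (fun i => ((z i)⁻¹).re) F (𝓝 (-(1 / 4))) :=
    (Complex.continuous_re.tendsto _).comp hl3lim
  have him : Tendsto (fun i => ((z i)⁻¹).im) F (𝓝 (√(15) / 4)) :=
    (Complex.continuous_im.tendsto _).comp hl3lim
  generalize hl : (fun i => (z i)⁻¹) = l at *
  have hli : ∀ i, (z i)⁻¹ = l i := fun i => congrFun hl i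
  simp only [hli] at hl3 hre him
  let r : ι → ℝ := fun i => 1 + 2 * (l i).re
  let s : ι → ℝ := fun i =>
    A i - ((l i).re ^ 2 + (l i).im ^ 2) + 2 * (l i).re * (1 + 2 * (l i).re)
  have hr : Tendsto r F (𝓝 (1 / 2)) := by
    convert (hre.const_mul 2).const_add 1 using 2
    norm_num
  have hsr : Tendsto (fun i => (s i - r i ^ 2 / 4) / (2 * x i)) F (𝓝 1) := by
    have hrest := (((hre.pow 2).add (him.pow 2)).neg.add
      ((hre.const_mul 2).mul hr)).sub ((hr.pow 2).div_const 4)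
    have h := (hA.add (hrest.mul hxinv)).div_const 2
    simp only [mul_zero, add_zero, div_self (two_ne_zero (α := ℝ))] at h
    refine h.congr' ?_
    filter_upwards [hxpos] with i hi
    simp only [s, r]
    field_simp
    ring
  refine ⟨fun i => ⟨-(r i / 2), √(s i - r i ^ 2 / 4)⟩, l, ?_, hl3, ?_, ?_, hre, him⟩
  · filter_upwards [hl3, him.eventually_ne h15pos.ne', hxpos,
      hsr.eventually_const_lt one_pos] with i hi himi hxi hpos
    have hpos' := (div_pos_iff_of_pos_right (by positivity)).mp hpos
    exact quartic_root_of_cofactor himi hi (quadratic_root_of_discrim_nonpos hpos'.le)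
  · convert (hr.div_const 2).neg using 2
    norm_num
  · have h := hsr.sqrt
    rw [Real.sqrt_one] at h
    refine h.congr' ?_
    filter_upwards [hxpos] with i hi
    exact Real.sqrt_div' _ (by positivity)

theorem charPoly_conj (α β γ μ : ℝ) (l : ℂ) :
    charPoly α β γ μ ((starRingEnd ℂ) l) = (starRingEnd ℂ) (charPoly α β γ μ l) := by
  simp only [charPoly, map_add, map_mul, map_pow, Complex.conj_ofReal]

theorem charPoly_roots_L34 (α β γ : ℝ)
    (h1 : α = (β + 1) / 2) (h2 : 0 < β) (h3 : β ≤ 1)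
    (h4 : γ = 1) :
    ∃ M > (0 : ℝ), ∃ l1 l3 : ℝ → ℂ,
      (∀ μ > M,
        charPoly α β γ μ (l1 μ) = 0 ∧ charPoly α β γ μ ((starRingEnd ℂ) (l1 μ)) = 0 ∧
        charPoly α β γ μ (l3 μ) = 0 ∧ charPoly α β γ μ ((starRingEnd ℂ) (l3 μ)) = 0) ∧
      Tendsto (fun μ : ℝ => (l1 μ).re / (-(1 / 4) : ℝ)) atTop (𝓝 1) ∧
      Tendsto (fun μ : ℝ => (l1 μ).im / (Real.sqrt 2 * μ ^ (β / 2))) atTop (𝓝 1) ∧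
      Tendsto (fun μ : ℝ => (l3 μ).re / (-(1 / 4) : ℝ)) atTop (𝓝 1) ∧
      Tendsto (fun μ : ℝ => (l3 μ).im / (Real.sqrt 15 / 4 : ℝ)) atTop (𝓝 1) ∧
      ∃ c > (0 : ℝ), ∃ M' : ℝ, ∀ μ > M', (l1 μ).re ≤ -c ∧ (l3 μ).re ≤ -c := by
  subst h1 h4
  let x : ℝ → ℝ := fun μ => μ ^ β
  let A : ℝ → ℝ := fun μ => (2 * (x μ * μ) + 2 * μ + x μ) / (μ + 1)
  let B : ℝ → ℝ := fun μ => (x μ * μ + 2 * μ) / (μ + 1)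
  let C : ℝ → ℝ := fun μ => 2 * (x μ * μ) / (μ + 1)
  have hx : Tendsto x atTop atTop := tendsto_rpow_atTop h2
  have hxinv : Tendsto (fun μ => (x μ)⁻¹) atTop (𝓝 0) := hx.inv_tendsto_atTop
  have hinv : Tendsto (fun μ : ℝ => μ⁻¹) atTop (𝓝 0) := tendsto_inv_atTop_zero
  have hpos : ∀ᶠ μ : ℝ in atTop, 0 < μ ∧ 0 < x μ :=
    (eventually_gt_atTop 0).and (hx.eventually_gt_atTop 0)
  have hden : Tendsto (fun μ : ℝ => 1 + μ⁻¹) atTop (𝓝 1) := by simpa using hinv.const_add 1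
  have hA : Tendsto (fun μ => A μ / x μ) atTop (𝓝 2) := by
    have h := (((hxinv.const_mul 2).const_add 2).add hinv).div hden one_ne_zero
    norm_num at h
    refine h.congr' ?_
    filter_upwards [hpos] with μ ⟨hμ, hxμ⟩
    simp only [A, Pi.div_apply]
    field_simp
  have hB : Tendsto (fun μ => B μ / x μ) atTop (𝓝 1) := by
    have h := ((hxinv.const_mul 2).const_add 1).div hden one_ne_zero
    norm_num at h
    refine h.congr' ?_
    filter_upwards [hpos] with μ ⟨hμ, hxμ⟩
    simp only [B, Pi.div_apply]
    field_simp
  have hC : Tendsto (fun μ => C μ / x μ) atTop (𝓝 2) := by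
    have h := (tendsto_const_nhds (x := (2 : ℝ))).div hden one_ne_zero
    norm_num at h
    refine h.congr' ?_
    filter_upwards [hpos] with μ ⟨hμ, hxμ⟩
    simp only [C, Pi.div_apply]
    field_simp
  obtain ⟨l1, l3, hl1, hl3, hre1, him1, hre3, him3⟩ := exists_tendsto_quartic_roots hx hA hB hC
  have hchar : ∀ μ : ℝ, 0 < μ → ∀ l : ℂ, l ^ 4 + l ^ 3 + A μ * l ^ 2 + B μ * l + C μ = 0 →
      charPoly ((β + 1) / 2) β 1 μ l = 0 := by
    intro μ hμ l h
    have hne : (μ : ℂ) + 1 ≠ 0 := by exact_mod_cast (by positivity : μ + 1 ≠ 0)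
    have hadd : μ ^ (β + 1) = x μ * μ := Real.rpow_add_one hμ.ne' β
    simp only [A, B, C] at h
    push_cast at h
    field_simp at h
    rw [charPoly, mul_div_cancel₀ _ (two_ne_zero (α := ℝ)), add_comm 1 β, hadd, Real.rpow_one]
    push_cast
    simp only [x] at h ⊢
    linear_combination h
  obtain ⟨M, hM⟩ := eventually_atTop.mp (hl1.and hl3)
  have hev := (hre1.eventually_le_const (show -(1 / 4) < -(1 / 8 : ℝ) by norm_num)).and
    (hre3.eventually_le_const (show -(1 / 4) < -(1 / 8 : ℝ) by norm_num))
  obtain ⟨M', hM'⟩ := eventually_atTop.mp hev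
  refine ⟨max M 1, by positivity, l1, l3, ?_, ?_, ?_, ?_, ?_, 1 / 8, by norm_num, M',
    fun μ hμ => hM' μ hμ.le⟩
  · intro μ hμ
    obtain ⟨hMμ, h1μ⟩ := max_lt_iff.mp hμ
    have h1 := hchar μ (by linarith) _ (hM μ hMμ.le).1
    have h3 := hchar μ (by linarith) _ (hM μ hMμ.le).2
    simp only [charPoly_conj, h1, h3, map_zero, and_self]
  · convert hre1.div_const (-(1 / 4)) using 2
    norm_num
  · refine him1.congr' ?_
    filter_upwards [eventually_gt_atTop 0] with μ hμ
    rw [Real.sqrt_mul zero_le_two, Real.sqrt_eq_rpow (x μ), ← Real.rpow_mul hμ.le,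
      mul_one_div]
  · convert hre3.div_const (-(1 / 4)) using 2
    norm_num
  · convert him3.div_const (√(15) / 4) using 2
    rw [div_self (by positivity)]
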